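/- For any n×n complex matrix A, the numerical range W(A) is a convex subset of ℂ (Toeplitz–Hausdorff theorem). -/

import Mathlib

open Matrix

/-- The numerical range of a complex `n × n` matrix. -/
def numRange {n : ℕ} (A : Matrix (Fin n) (Fin n) ℂ) : Set ℂ :=
  {z | ∃ x : Fin n → ℂ, star x ⬝ᵥ x = 1 ∧ star x ⬝ᵥ A.mulVec x = z}

theorem numRange_of_scaled {n : ℕ} (A : Matrix (Fin n) (Fin n) ℂ) (z : Fin n → ℂ) (N : ℝ)
    (hN : 0 < N) (h1 : star z ⬝ᵥ z = (N : ℂ)) (c : ℂ) (h2 : star z ⬝ᵥ A.mulVec z = c * N) :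
    c ∈ numRange A := by
  have hs : ((Real.sqrt N : ℝ) : ℂ) * (Real.sqrt N : ℝ) = N := by
    rw [← Complex.ofReal_mul, Real.mul_self_sqrt hN.le]
  have hs0 : ((Real.sqrt N : ℝ) : ℂ) ≠ 0 := by
    exact_mod_cast (Real.sqrt_pos.2 hN).ne'
  have hst : star (((Real.sqrt N : ℝ) : ℂ)⁻¹) = ((Real.sqrt N : ℝ) : ℂ)⁻¹ := by simp
  refine ⟨((Real.sqrt N : ℝ) : ℂ)⁻¹ • z, ?_, ?_⟩
  · rw [star_smul, hst, smul_dotProduct, dotProduct_smul, h1, ← hs]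
    simp only [smul_eq_mul]
    field_simp
  · rw [star_smul, hst, mulVec_smul, smul_dotProduct, dotProduct_smul, h2, ← hs]
    simp only [smul_eq_mul]
    field_simp

theorem exists_phase (e : ℂ) : ∃ m : ℂ, star m * m = 1 ∧ (m * e).im = 0 := by
  by_cases he : e = 0
  · exact ⟨1, by simp, by simp [he]⟩
  · have hn : (‖e‖ : ℂ) ≠ 0 := by exact_mod_cast norm_ne_zero_iff.2 he
    have h : star e * e = (‖e‖ : ℂ) * ‖e‖ := by
      have := Complex.conj_mul' e
      rw [← sq]; exact this
    refine ⟨star e / ‖e‖, ?_, ?_⟩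
    · have : star (star e / (‖e‖ : ℂ)) = e / ‖e‖ := by simp
      rw [this, div_mul_div_comm, mul_comm e, h, div_self (mul_ne_zero hn hn)]
    · have : star e / (‖e‖ : ℂ) * e = (‖e‖ : ℂ) := by
        rw [div_mul_eq_mul_div, h]; field_simp
      rw [this]; simp

/-- Toeplitz–Hausdorff theorem: the numerical range of any
`n × n` complex matrix is convex. -/
theorem numRange_convex {n : ℕ} (A : Matrix (Fin n) (Fin n) ℂ) :
    Convex ℝ (numRange A) := by
  rintro a ⟨x, hx, hxa⟩ b ⟨y, hy, hyb⟩ t u ht hu htu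
  by_cases hab : a = b
  · subst hab
    rw [← add_smul, htu, one_smul]
    exact ⟨x, hx, hxa⟩
  have hw : a - b ≠ 0 := sub_ne_zero.2 hab
  obtain ⟨m, hm, him⟩ := exists_phase ((star x ⬝ᵥ A.mulVec y - b * (star x ⬝ᵥ y)) / (a - b)
    - star ((star y ⬝ᵥ A.mulVec x - b * (star y ⬝ᵥ x)) / (a - b)))
  -- replace `y` by a phase multiple
  obtain ⟨v, hv, hvb, k, hk⟩ : ∃ v : Fin n → ℂ, star v ⬝ᵥ v = 1 ∧ star v ⬝ᵥ A.mulVec v = b ∧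
      ∃ k : ℝ, (star x ⬝ᵥ A.mulVec v - b * (star x ⬝ᵥ v)) +
        (star v ⬝ᵥ A.mulVec x - b * (star v ⬝ᵥ x)) = (a - b) * k := by
    refine ⟨m • y, ?_, ?_, ?_⟩
    · rw [star_smul, smul_dotProduct, dotProduct_smul, hy, smul_eq_mul, smul_eq_mul, mul_one, hm]
    · rw [star_smul, mulVec_smul, smul_dotProduct, dotProduct_smul, hyb, smul_eq_mul, smul_eq_mul,
        ← mul_assoc, hm, one_mul]
    · simp only [star_smul, mulVec_smul, smul_dotProduct, dotProduct_smul, smul_eq_mul]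
      generalize hP : (star x ⬝ᵥ A.mulVec y - b * (star x ⬝ᵥ y)) / (a - b) = P at him
      generalize hQ : (star y ⬝ᵥ A.mulVec x - b * (star y ⬝ᵥ x)) / (a - b) = Q at him
      rw [div_eq_iff hw] at hP hQ
      refine ⟨(m * P + star m * Q).re, ?_⟩
      have hr : (((m * P + star m * Q).re : ℝ) : ℂ) = m * P + star m * Q := by
        apply Complex.ext
        · simp
        · simp at him ⊢
          linarith
      rw [hr]
      linear_combination m * hP + star m * hQ
  obtain ⟨h, hh⟩ : ∃ h : ℝ, star x ⬝ᵥ v + star v ⬝ᵥ x = h := by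
    refine ⟨2 * (star x ⬝ᵥ v).re, ?_⟩
    have : star v ⬝ᵥ x = star (star x ⬝ᵥ v) := by
      rw [star_dotProduct]
    rw [this]
    apply Complex.ext <;> simp
    ring
  -- intermediate value
  obtain ⟨r, hr⟩ : ∃ r : ℝ, r ^ 2 + r * (1 - r) * k =
      t * (r ^ 2 + (1 - r) ^ 2 + r * (1 - r) * h) := by
    have hc : ContinuousOn (fun r : ℝ => r ^ 2 + r * (1 - r) * k -
      t * (r ^ 2 + (1 - r) ^ 2 + r * (1 - r) * h)) (Set.Icc 0 1) := by fun_prop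
    have := intermediate_value_Icc (zero_le_one (α := ℝ)) hc
    obtain ⟨r, -, hr⟩ := this (show (0 : ℝ) ∈ _ by constructor <;> norm_num <;> linarith)
    exact ⟨r, sub_eq_zero.1 hr⟩
  have hrC : (r : ℂ) ^ 2 + r * (1 - r) * k =
      t * (r ^ 2 + (1 - r) ^ 2 + r * (1 - r) * h) := by exact_mod_cast hr
  have hstr : ∀ q : ℝ, star (q : ℂ) = q := fun q => by simp
  have hN : star ((r : ℂ) • x + ((1 - r : ℝ) : ℂ) • v) ⬝ᵥ ((r : ℂ) • x + ((1 - r : ℝ) : ℂ) • v)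
      = ((r ^ 2 + (1 - r) ^ 2 + r * (1 - r) * h : ℝ) : ℂ) := by
    simp only [star_add, star_smul, hstr, add_dotProduct, dotProduct_add, smul_dotProduct,
      dotProduct_smul, smul_eq_mul, hx, hv]
    push_cast
    linear_combination (r : ℂ) * (1 - r) * hh
  have hz : (r : ℂ) • x + ((1 - r : ℝ) : ℂ) • v ≠ 0 := by
    intro h0
    have h1 : (r : ℂ) • x = (-((1 - r : ℝ) : ℂ)) • v := by
      rw [neg_smul]; exact eq_neg_of_add_eq_zero_left h0
    have e1 := congrArg (fun z => star z ⬝ᵥ z) h1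
    have e2 := congrArg (fun z => star z ⬝ᵥ A.mulVec z) h1
    simp only [star_smul, star_neg, hstr, mulVec_smul, smul_dotProduct, dotProduct_smul,
      smul_eq_mul, hx, hv, hxa, hvb] at e1 e2
    push_cast at e1 e2
    have e3 : (r : ℂ) ^ 2 * (a - b) = 0 := by linear_combination e2 - b * e1
    have e4 : (r : ℂ) = 0 := by simpa [hw] using e3
    simp [e4] at e1
  refine numRange_of_scaled A _ _ ?_ hN _ ?_
  · open ComplexOrder in
    have hp := dotProduct_star_self_pos_iff.2 hz
    rw [hN] at hp
    exact_mod_cast hp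
  · have hu' : (u : ℂ) = 1 - t := by
      have h3 : u = 1 - t := by linarith
      rw [h3]; push_cast; ring
    simp only [star_add, star_smul, hstr, add_dotProduct, dotProduct_add, smul_dotProduct,
      dotProduct_smul, smul_eq_mul, hxa, hvb, mulVec_add, mulVec_smul, Complex.real_smul, hu']
    push_cast
    linear_combination (r : ℂ) * (1 - r) * hk + (a - b) * hrC + b * r * (1 - r) * hh
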